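/- Let G be a connected k-regular digraph with χ⃗(G) = k + 1 (k = Δ_max(G)) that is not one of the exceptional digraphs (directed cycle, symmetric odd cycle, symmetric complete graph). If {u, v} is a 2-vertex cutset of the underlying graph of G, then there is no arc between u and v in G. -/

import Mathlib

/-- A digraph: no loops, no parallel arcs (arcs given by a relation), digons allowed. -/
structure Digraph' (V : Type) where
  Adj : V → V → Prop
  irrefl : ∀ v, ¬ Adj v v

namespace Digraph'

variable {V : Type} (G : Digraph' V)

/-- Out-degree of a vertex. -/
noncomputable def outDeg (v : V) : ℕ := Nat.card {w : V // G.Adj v w}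

/-- In-degree of a vertex. -/
noncomputable def inDeg (v : V) : ℕ := Nat.card {w : V // G.Adj w v}

/-- `d_min(v) = min(d⁺(v), d⁻(v))`. -/
noncomputable def dmin (v : V) : ℕ := min (G.outDeg v) (G.inDeg v)

/-- `d_max(v) = max(d⁺(v), d⁻(v))`. -/
noncomputable def dmax (v : V) : ℕ := max (G.outDeg v) (G.inDeg v)

/-- `Δ_min(G) = max_v min(d⁺(v), d⁻(v))`. -/
noncomputable def DeltaMin : ℕ := sSup (Set.range G.dmin)

/-- `Δ_max(G) = max_v max(d⁺(v), d⁻(v))`. -/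
noncomputable def DeltaMax : ℕ := sSup (Set.range G.dmax)

/-- A set of vertices is acyclic if it carries no directed cycle. -/
def AcyclicSet (S : Set V) : Prop :=
  ∀ v : V, ¬ Relation.TransGen (fun x y => x ∈ S ∧ y ∈ S ∧ G.Adj x y) v v

/-- `G` is `k`-dicolourable: its vertex set partitions into `k` acyclic colour classes. -/
def Dicolourable (k : ℕ) : Prop :=
  ∃ f : V → Fin k, ∀ c : Fin k, G.AcyclicSet {v | f v = c}

/-- The dichromatic number. -/
noncomputable def dichromaticNumber : ℕ := sInf {k | G.Dicolourable k}

/-- `G` is connected (its underlying undirected graph is connected). -/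
def Connected : Prop :=
  Nonempty V ∧ ∀ x y : V, Relation.ReflTransGen (fun a b => G.Adj a b ∨ G.Adj b a) x y

/-- The subdigraph induced on a set of vertices. -/
def induce (S : Set V) : Digraph' S :=
  ⟨fun a b => G.Adj a b, fun a h => G.irrefl a h⟩

/-- The connected component (of the underlying graph) containing `v`. -/
def component (v : V) : Set V :=
  {u | Relation.ReflTransGen (fun a b => G.Adj a b ∨ G.Adj b a) v u}

/-- `G` is a directed cycle. -/
def IsDirectedCycle : Prop :=
  ∃ n : ℕ, 2 ≤ n ∧ ∃ e : V ≃ ZMod n, ∀ x y : V, G.Adj x y ↔ e y = e x + 1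

/-- `G` is a symmetric cycle of odd length. -/
def IsSymmetricOddCycle : Prop :=
  ∃ n : ℕ, 3 ≤ n ∧ Odd n ∧ ∃ e : V ≃ ZMod n,
    ∀ x y : V, G.Adj x y ↔ (e y = e x + 1 ∨ e x = e y + 1)

/-- `G` is a symmetric complete digraph (a digon between any two distinct vertices). -/
def IsSymmetricComplete : Prop := ∀ x y : V, G.Adj x y ↔ x ≠ y

/-- `G` is a member of `𝓑_k`: directed cycles for `k = 1`, symmetric odd cycles for
`k = 2`, and the symmetric complete digraph on `k+1` vertices for `k ≥ 3`. -/
def IsException (k : ℕ) : Prop :=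
  (k = 1 ∧ G.IsDirectedCycle) ∨ (k = 2 ∧ G.IsSymmetricOddCycle) ∨
  (3 ≤ k ∧ G.IsSymmetricComplete ∧ Nat.card V = k + 1)

end Digraph'

namespace Digraph'

section Helpers

variable {V : Type} (G : Digraph' V)

lemma AcyclicSet.mono {S T : Set V} (h : G.AcyclicSet T) (hST : S ⊆ T) : G.AcyclicSet S := by
  intro x hx
  exact h x (hx.lift id (fun a b hab => ⟨hST hab.1, hST hab.2.1, hab.2.2⟩))

lemma acyclic_insert_out {U : Set V} (h : G.AcyclicSet U) (w : V)
    (hw : ∀ x ∈ U, ¬ G.Adj w x) : G.AcyclicSet (insert w U) := by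
  have hout : ∀ y, ¬ (w ∈ insert w U ∧ y ∈ insert w U ∧ G.Adj w y) := by
    rintro y ⟨_, hy, hadj⟩
    rcases hy with rfl | hy
    · exact G.irrefl _ hadj
    · exact hw y hy hadj
  have key : ∀ x y, Relation.TransGen
      (fun a b => a ∈ insert w U ∧ b ∈ insert w U ∧ G.Adj a b) x y →
      y = w ∨ Relation.TransGen (fun a b => a ∈ U ∧ b ∈ U ∧ G.Adj a b) x y := by
    have step : ∀ a b, (a ∈ insert w U ∧ b ∈ insert w U ∧ G.Adj a b) →
        b = w ∨ (a ∈ U ∧ b ∈ U ∧ G.Adj a b) := by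
      intro a b hab
      rcases hab.1 with ha | ha
      · subst ha; exact absurd hab (hout b)
      · rcases hab.2.1 with hb | hb
        · exact Or.inl hb
        · exact Or.inr ⟨ha, hb, hab.2.2⟩
    intro x y hxy
    induction hxy with
    | single h1 => exact (step _ _ h1).imp id Relation.TransGen.single
    | tail _ h2 ih =>
      rcases ih with ih | ih
      · subst ih; exact absurd h2 (hout _)
      · exact (step _ _ h2).imp id (fun q => ih.tail q)
  intro x hx
  rcases key x x hx with hxw | h'
  · subst hxw
    obtain ⟨b, hb, _⟩ := Relation.TransGen.head'_iff.1 hx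
    exact hout b hb
  · exact h x h'

/-- The reversed digraph. -/
def rev : Digraph' V := ⟨fun a b => G.Adj b a, G.irrefl⟩

lemma acyclic_rev {S : Set V} (h : G.AcyclicSet S) : G.rev.AcyclicSet S := by
  intro x hx
  apply h x
  rw [← Relation.transGen_swap]
  exact hx.lift id (fun a b hab => ⟨hab.2.1, hab.1, hab.2.2⟩)

lemma acyclic_insert_in {U : Set V} (h : G.AcyclicSet U) (w : V)
    (hw : ∀ x ∈ U, ¬ G.Adj x w) : G.AcyclicSet (insert w U) :=
  G.rev.acyclic_rev (G.rev.acyclic_insert_out (G.acyclic_rev h) w hw)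

lemma acyclic_union {T₁ T₂ : Set V} (h₁ : G.AcyclicSet T₁) (h₂ : G.AcyclicSet T₂)
    (harc : ∀ x ∈ T₁ ∪ T₂, ∀ y ∈ T₁ ∪ T₂, G.Adj x y → (x ∈ T₁ ∧ y ∈ T₁) ∨ (x ∈ T₂ ∧ y ∈ T₂))
    (hK : ∀ a ∈ T₁ ∩ T₂, ∀ b ∈ T₁ ∩ T₂,
      Relation.TransGen (fun x y => x ∈ T₂ ∧ y ∈ T₂ ∧ G.Adj x y) a b →
      Relation.TransGen (fun x y => x ∈ T₁ ∧ y ∈ T₁ ∧ G.Adj x y) a b) :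
    G.AcyclicSet (T₁ ∪ T₂) := by
  set R₁ := (fun x y => x ∈ T₁ ∧ y ∈ T₁ ∧ G.Adj x y) with hR₁
  set R₂ := (fun x y => x ∈ T₂ ∧ y ∈ T₂ ∧ G.Adj x y) with hR₂
  set R := (fun x y => x ∈ T₁ ∪ T₂ ∧ y ∈ T₁ ∪ T₂ ∧ G.Adj x y) with hR
  have hs1 : ∀ x y, R x y → x ∈ T₁ → y ∈ T₁ → R₁ x y := fun x y h a b => ⟨a, b, h.2.2⟩
  have hs2 : ∀ x y, R x y → ¬ (x ∈ T₁ ∧ y ∈ T₁) → R₂ x y := by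
    intro x y h n
    rcases harc x h.1 y h.2.1 h.2.2 with h' | h'
    · exact absurd h' n
    · exact ⟨h'.1, h'.2, h.2.2⟩
  have key : ∀ x ∈ T₁, ∀ y, Relation.TransGen R x y →
      (y ∈ T₁ ∧ Relation.TransGen R₁ x y) ∨
      (y ∉ T₁ ∧ ∃ z ∈ T₁ ∩ T₂, Relation.ReflTransGen R₁ x z ∧ Relation.TransGen R₂ z y) := by
    intro x hx y hxy
    induction hxy with
    | single h =>
      rename_i b
      by_cases hb : b ∈ T₁
      · exact Or.inl ⟨hb, .single (hs1 _ _ h hx hb)⟩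
      · have := hs2 _ _ h (fun q => hb q.2)
        exact Or.inr ⟨hb, x, ⟨hx, this.1⟩, .refl, .single this⟩
    | tail _ h ih =>
      rename_i b c _
      rcases ih with ⟨hb, ih⟩ | ⟨hb, z, hz, hxz, hzb⟩
      · by_cases hc : c ∈ T₁
        · exact Or.inl ⟨hc, ih.tail (hs1 _ _ h hb hc)⟩
        · have := hs2 _ _ h (fun q => hc q.2)
          exact Or.inr ⟨hc, b, ⟨hb, this.1⟩, ih.to_reflTransGen, .single this⟩
      · have hbc := hs2 _ _ h (fun q => hb q.1)
        by_cases hc : c ∈ T₁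
        · exact Or.inl ⟨hc, Relation.TransGen.trans_right hxz
            (hK z hz c ⟨hc, hbc.2.1⟩ (hzb.tail hbc))⟩
        · exact Or.inr ⟨hc, z, hz, hxz, hzb.tail hbc⟩
  have no1 : ∀ x ∈ T₁, ¬ Relation.TransGen R x x := by
    intro x hx h
    rcases key x hx x h with h' | h'
    · exact h₁ x h'.2
    · exact h'.1 hx
  have key2 : ∀ x y, Relation.TransGen R x y → Relation.TransGen R₂ x y ∨
      ∃ z ∈ T₁, Relation.TransGen R x z ∧ Relation.ReflTransGen R z y := by
    intro x y hxy
    induction hxy with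
    | single h =>
      rename_i b
      by_cases hb : b ∈ T₁
      · exact Or.inr ⟨b, hb, .single h, .refl⟩
      · exact Or.inl (.single (hs2 _ _ h (fun q => hb q.2)))
    | tail hxb h ih =>
      rename_i b c
      rcases ih with ih | ⟨z, hz, hxz, hzb⟩
      · by_cases hc : c ∈ T₁
        · exact Or.inr ⟨c, hc, hxb.tail h, .refl⟩
        · exact Or.inl (ih.tail (hs2 _ _ h (fun q => hc q.2)))
      · exact Or.inr ⟨z, hz, hxz, hzb.tail h⟩
  intro x hx
  rcases key2 x x hx with h | ⟨z, hz, hxz, hzx⟩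
  · exact h₂ x h
  · exact no1 z hz (Relation.TransGen.trans_right hzx hxz)

/-- `f` restricted to `S` is a dicolouring of the subdigraph induced by `S`. -/
def Col {k : ℕ} (S : Set V) (f : V → Fin k) : Prop :=
  ∀ c, G.AcyclicSet {w | w ∈ S ∧ f w = c}

open Classical in
lemma col_update {k : ℕ} {S : Set V} {f : V → Fin k} {w : V} {c : Fin k}
    (hf : G.Col (S \ {w}) f) (hw : (∀ x ∈ S, f x = c → ¬ G.Adj w x) ∨
      (∀ x ∈ S, f x = c → ¬ G.Adj x w)) : G.Col S (Function.update f w c) := by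
  intro d
  by_cases hd : d = c
  · subst hd
    have hsub : {x | x ∈ S ∧ Function.update f w d x = d} ⊆
        insert w {x | x ∈ S \ {w} ∧ f x = d} := by
      rintro x ⟨hx, hxd⟩
      by_cases hxw : x = w
      · exact Or.inl hxw
      · rw [Function.update_of_ne hxw] at hxd
        exact Or.inr ⟨⟨hx, hxw⟩, hxd⟩
    refine AcyclicSet.mono G ?_ hsub
    rcases hw with hw | hw
    · exact G.acyclic_insert_out (hf d) w (fun x hx => hw x hx.1.1 hx.2)
    · exact G.acyclic_insert_in (hf d) w (fun x hx => hw x hx.1.1 hx.2)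
  · refine AcyclicSet.mono G (hf d) ?_
    rintro x ⟨hx, hxd⟩
    by_cases hxw : x = w
    · subst hxw
      rw [Function.update_self] at hxd
      exact absurd hxd.symm hd
    · rw [Function.update_of_ne hxw] at hxd
      exact ⟨⟨hx, hxw⟩, hxd⟩

lemma Col.mono {k : ℕ} {S T : Set V} {f : V → Fin k} (h : G.Col T f) (hST : S ⊆ T) :
    G.Col S f := fun c => AcyclicSet.mono G (h c) (fun _ hx => ⟨hST hx.1, hx.2⟩)

/-- If `k` distinct elements of a `k`-element subtype are listed, they are all of them. -/
lemma range_of_card [Fintype V] {k : ℕ} {P : V → Prop} (hP : Nat.card {w // P w} = k)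
    (W : Fin k → V) (hW : ∀ c, P (W c)) (hinj : Function.Injective W) {w : V} (hw : P w) :
    ∃ c, W c = w := by
  classical
  have hb : Function.Bijective (fun c => (⟨W c, hW c⟩ : {w // P w})) := by
    rw [Fintype.bijective_iff_injective_and_card]
    refine ⟨fun a b hab => hinj (congrArg Subtype.val hab), ?_⟩
    rw [← Nat.card_eq_fintype_card (α := {w // P w}), hP, Fintype.card_fin]
  obtain ⟨c, hc⟩ := hb.2 ⟨w, hw⟩
  exact ⟨c, congrArg Subtype.val hc⟩

/-- If `y` satisfies `P` and lies outside `S`, some colour misses `P ∩ S`. -/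
lemma missing_colour [Fintype V] {k : ℕ} {P : V → Prop} (hP : Nat.card {w // P w} = k)
    (S : Set V) (f : V → Fin k) {y : V} (hy : P y) (hyS : y ∉ S) :
    ∃ c, ∀ x ∈ S, f x = c → ¬ P x := by
  by_contra hcon
  push Not at hcon
  choose W hWS hWf hWP using hcon
  obtain ⟨c, hc⟩ := range_of_card hP W hWP
    (fun a b hab => by rw [← hWf a, ← hWf b, hab]) hy
  exact hyS (hc ▸ hWS c)

lemma proper_col [Fintype V] {k : ℕ} (hkpos : 0 < k)
    (hreg : ∀ v : V, G.outDeg v = k ∧ G.inDeg v = k) (hc : G.Connected) :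
    ∀ (n : ℕ) (S : Set V), S.ncard = n → (∃ y, y ∉ S) → ∃ f : V → Fin k, G.Col S f := by
  classical
  intro n
  induction n with
  | zero =>
    intro S hS _
    rw [Set.ncard_eq_zero] at hS
    subst hS
    refine ⟨fun _ => ⟨0, hkpos⟩, fun c x hx => ?_⟩
    obtain ⟨b, hb, _⟩ := Relation.TransGen.head'_iff.1 hx
    exact hb.1.1
  | succ n ih =>
    intro S hS ⟨y, hy⟩
    have hne : S.Nonempty := by
      rw [Set.nonempty_iff_ne_empty]; rintro rfl; simp at hS
    obtain ⟨x, hx⟩ := hne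
    have hex : ∃ a ∈ S, ∃ b, b ∉ S ∧ (G.Adj a b ∨ G.Adj b a) := by
      by_contra hcon
      push Not at hcon
      have : ∀ z, Relation.ReflTransGen (fun a b => G.Adj a b ∨ G.Adj b a) x z → z ∈ S := by
        intro z hz
        induction hz with
        | refl => exact hx
        | tail _ h ih' =>
          by_contra hcS
          have := hcon _ ih' _ hcS
          tauto
      exact hy (this y (hc.2 x y))
    obtain ⟨a, ha, b, hb, hab⟩ := hex
    obtain ⟨f, hf⟩ := ih (S \ {a}) (by rw [Set.ncard_diff_singleton_of_mem ha, hS]; rfl)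
      ⟨y, fun h => hy h.1⟩
    rcases hab with hab | hab
    · obtain ⟨c, hcc⟩ := missing_colour (hreg a).1 S f hab hb
      exact ⟨_, G.col_update hf (Or.inl hcc)⟩
    · obtain ⟨c, hcc⟩ := missing_colour (hreg a).2 S f hab hb
      exact ⟨_, G.col_update hf (Or.inr hcc)⟩

lemma exists_perm {k : ℕ} (a b c d : Fin k) (h : a = b ↔ c = d) :
    ∃ σ : Equiv.Perm (Fin k), σ a = c ∧ σ b = d := by
  by_cases hab : a = b
  · have hcd := h.1 hab
    subst hab; subst hcd
    exact ⟨Equiv.swap a c, by simp, by simp⟩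
  · have hcd : c ≠ d := fun e => hab (h.2 e)
    refine ⟨Equiv.swap (Equiv.swap a c b) d * Equiv.swap a c, ?_, by simp⟩
    rw [Equiv.Perm.mul_apply, Equiv.swap_apply_left]
    refine Equiv.swap_apply_of_ne_of_ne ?_ hcd
    intro e
    apply hab
    apply (Equiv.swap a c).injective
    rw [← e, Equiv.swap_apply_left]

/-- The two sides of a 2-vertex cutset. -/
structure Sep (u v : V) (A B : Set V) : Prop where
  uA : u ∉ A
  vA : v ∉ A
  uB : u ∉ B
  vB : v ∉ B
  disj : ∀ w, w ∈ A → w ∉ B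
  cover : ∀ w, w = u ∨ w = v ∨ w ∈ A ∨ w ∈ B
  noAB : ∀ a ∈ A, ∀ b ∈ B, ¬ G.Adj a b
  noBA : ∀ a ∈ A, ∀ b ∈ B, ¬ G.Adj b a
  neA : A.Nonempty
  neB : B.Nonempty

lemma Sep.symm {u v : V} {A B : Set V} (h : G.Sep u v A B) : G.Sep u v B A where
  uA := h.uB
  vA := h.vB
  uB := h.uA
  vB := h.vA
  disj w hw hA := h.disj w hA hw
  cover w := by have := h.cover w; tauto
  noAB b hb a ha := h.noBA a ha b hb
  noBA b hb a ha := h.noAB a ha b hb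
  neA := h.neB
  neB := h.neA

open Classical in
lemma merge {k : ℕ} {u v : V} {A B : Set V} (hs : G.Sep u v A B) (huv : u ≠ v)
    (harc : G.Adj u v) {f g : V → Fin k} (hf : G.Col Bᶜ f) (hg : G.Col Aᶜ g)
    (hfg : g u = g v ↔ f u = f v) : G.Dicolourable k := by
  obtain ⟨σ, hσu, hσv⟩ := exists_perm _ _ _ _ hfg
  refine ⟨fun w => if w ∈ B then σ (g w) else f w, fun c => ?_⟩
  have hg' : G.AcyclicSet {w | w ∈ Aᶜ ∧ σ (g w) = c} := by
    refine AcyclicSet.mono G (hg (σ.symm c)) ?_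
    rintro w ⟨hw, hwc⟩
    exact ⟨hw, by rw [← hwc]; simp⟩
  have hf' := hf c
  have huv' : ∀ w, w ∈ Aᶜ → w ∈ Bᶜ → w = u ∨ w = v := by
    intro w h1 h2
    rcases hs.cover w with h | h | h | h
    · exact Or.inl h
    · exact Or.inr h
    · exact absurd h h1
    · exact absurd h h2
  refine AcyclicSet.mono G (G.acyclic_union hf' hg' ?_ ?_) ?_
  · have huni : ∀ x, x ∈ {w | w ∈ Bᶜ ∧ f w = c} ∪ {w | w ∈ Aᶜ ∧ σ (g w) = c} →
        (x ∈ Bᶜ → f x = c) ∧ (x ∈ Aᶜ → σ (g x) = c) := by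
      rintro x (⟨hx, hxc⟩ | ⟨hx, hxc⟩)
      · refine ⟨fun _ => hxc, fun hxA => ?_⟩
        rcases huv' x hxA hx with rfl | rfl
        · rw [hσu, hxc]
        · rw [hσv, hxc]
      · refine ⟨fun hxB => ?_, fun _ => hxc⟩
        rcases huv' x hx hxB with rfl | rfl
        · rw [← hσu, hxc]
        · rw [← hσv, hxc]
    intro x hx y hy hxy
    have hx' := huni x hx
    have hy' := huni y hy
    by_cases hxB : x ∈ B
    · have hxA : x ∈ Aᶜ := fun h => hs.disj x h hxB
      have hyA : y ∈ Aᶜ := fun h => hs.noBA y h x hxB hxy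
      exact Or.inr ⟨⟨hxA, hx'.2 hxA⟩, ⟨hyA, hy'.2 hyA⟩⟩
    · by_cases hyB : y ∈ B
      · have hyA : y ∈ Aᶜ := fun h => hs.disj y h hyB
        have hxA : x ∈ Aᶜ := fun h => hs.noAB x h y hyB hxy
        exact Or.inr ⟨⟨hxA, hx'.2 hxA⟩, ⟨hyA, hy'.2 hyA⟩⟩
      · exact Or.inl ⟨⟨hxB, hx'.1 hxB⟩, ⟨hyB, hy'.1 hyB⟩⟩
  · rintro a ⟨ha1, ha2⟩ b ⟨hb1, hb2⟩ hab
    rcases huv' a ha2.1 ha1.1 with rfl | rfl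
    · rcases huv' b hb2.1 hb1.1 with rfl | rfl
      · exact absurd hab (hg' _)
      · exact .single ⟨ha1, hb1, harc⟩
    · rcases huv' b hb2.1 hb1.1 with rfl | rfl
      · exact absurd (hab.tail ⟨hb2, ha2, harc⟩) (hg' _)
      · exact absurd hab (hg' _)
  · intro w hw
    simp only [Set.mem_setOf_eq] at hw
    by_cases hwB : w ∈ B
    · rw [if_pos hwB] at hw
      exact Or.inr ⟨fun h => hs.disj w h hwB, hw⟩
    · rw [if_neg hwB] at hw
      exact Or.inl ⟨hwB, hw⟩

open Classical in
/-- If one side only has colourings with `u`, `v` alike, the other one has one, too. -/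
lemma other_side [Fintype V] {k : ℕ} {u v : V} {A B : Set V} (hs : G.Sep u v A B) (huv : u ≠ v)
    (harc : G.Adj u v) (hreg : ∀ v : V, G.outDeg v = k ∧ G.inDeg v = k)
    {f g : V → Fin k} (hf : G.Col Bᶜ f) (hg : G.Col Aᶜ g)
    (hall : ∀ f : V → Fin k, G.Col Bᶜ f → f u = f v) :
    ∃ g : V → Fin k, G.Col Aᶜ g ∧ g u = g v := by
  have hfuv := hall f hf
  have hvu : ¬ G.Adj v u := by
    intro h
    refine hf (f u) u ((Relation.TransGen.single ⟨⟨hs.uB, rfl⟩, ⟨hs.vB, hfuv.symm⟩, harc⟩).tail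
      ⟨⟨hs.vB, hfuv.symm⟩, ⟨hs.uB, rfl⟩, h⟩)
  -- every other colour is seen from `u` and from `v` inside `A`
  have hsee : ∀ p, (p = u ∨ p = v) → ∀ c, c ≠ f p → ∃ w ∈ A, G.Adj p w ∧ f w = c := by
    intro p hp c hcp
    by_contra hcon
    push Not at hcon
    have hcol : G.Col Bᶜ (Function.update f p c) := by
      refine G.col_update (Col.mono G hf Set.diff_subset) (Or.inl ?_)
      intro x hx hxc hadj
      rcases hs.cover x with rfl | rfl | h | h
      · rcases hp with rfl | rfl
        · exact hcp hxc.symm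
        · exact hcp (by rw [← hxc, hfuv])
      · rcases hp with rfl | rfl
        · exact hcp (by rw [← hxc, hfuv])
        · exact hcp hxc.symm
      · exact hcon x h hadj hxc
      · exact hx h
    have := hall _ hcol
    rcases hp with rfl | rfl
    · rw [Function.update_self, Function.update_of_ne huv.symm] at this
      exact hcp (by rw [this, hfuv])
    · rw [Function.update_self, Function.update_of_ne huv] at this
      exact hcp (by rw [← this, hfuv])
  have hnb : ∀ p, (p = u ∨ p = v) → ∀ q, q ∉ A → G.Adj p q → ∀ r, G.Adj p r → r = q ∨ r ∈ A := by
    intro p hp q hqA hpq r hpr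
    have : Nonempty V := ⟨u⟩
    choose! W hWA hWadj hWf using hsee p hp
    obtain ⟨c, hc⟩ := range_of_card (hreg p).1 (fun c => if c = f p then q else W c)
      (by
        intro c
        by_cases h : c = f p
        · simpa [h] using hpq
        · simpa [h] using hWadj c h)
      (by
        intro a b hab
        by_cases ha : a = f p <;> by_cases hb : b = f p
        · rw [ha, hb]
        · simp only [if_pos ha, if_neg hb] at hab
          exact absurd (hab ▸ hWA b hb) hqA
        · simp only [if_neg ha, if_pos hb] at hab
          exact absurd (hab ▸ hWA a ha) hqA
        · simp only [if_neg ha, if_neg hb] at hab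
          rw [← hWf a ha, ← hWf b hb, hab]) hpr
    by_cases h : c = f p
    · simp only [if_pos h] at hc
      exact Or.inl hc.symm
    · simp only [if_neg h] at hc
      exact Or.inr (hc ▸ hWA c h)
  have huB : ∀ x ∈ B, ¬ G.Adj u x := by
    intro x hx hadj
    rcases hnb u (Or.inl rfl) v hs.vA harc x hadj with rfl | h
    · exact hs.vB hx
    · exact hs.disj x h hx
  by_cases hguv : g u = g v
  · exact ⟨g, hg, hguv⟩
  have hcol : ∃ c, ∀ x ∈ B, g x = c → ¬ G.Adj v x := by
    by_cases hx : ∃ x ∈ B, G.Adj v x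
    · obtain ⟨x, hxB, hvx⟩ := hx
      have : ∃ c, c ≠ g x := by
        by_cases h : g u = g x
        · exact ⟨g v, fun e => hguv (by rw [h, e])⟩
        · exact ⟨g u, h⟩
      obtain ⟨c, hc⟩ := this
      refine ⟨c, fun y hy hyc hvy => ?_⟩
      rcases hnb v (Or.inr rfl) x (fun h => hs.disj x h hxB) hvx y hvy with rfl | h
      · exact hc hyc.symm
      · exact hs.disj y h hy
    · exact ⟨g u, fun y hy _ hvy => hx ⟨y, hy, hvy⟩⟩
  obtain ⟨c, hc⟩ := hcol
  have hcov : ∀ x ∈ Aᶜ, x = u ∨ x = v ∨ x ∈ B := by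
    intro x hx
    rcases hs.cover x with h | h | h | h
    · exact Or.inl h
    · exact Or.inr (Or.inl h)
    · exact absurd h hx
    · exact Or.inr (Or.inr h)
  have hg1 : G.Col (Aᶜ \ {v}) (Function.update g u c) := by
    refine G.col_update (Col.mono G hg (fun x hx => hx.1.1)) (Or.inl ?_)
    intro x hx _ hadj
    rcases hcov x hx.1 with rfl | h | h
    · exact G.irrefl _ hadj
    · exact hx.2 h
    · exact huB x h hadj
  refine ⟨Function.update (Function.update g u c) v c, G.col_update hg1 (Or.inl ?_), ?_⟩
  · intro x hx hxc hadj
    rcases hcov x hx with rfl | rfl | h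
    · exact hvu hadj
    · exact G.irrefl _ hadj
    · have hxu : x ≠ u := by
        rintro rfl
        exact hs.uB h
      rw [Function.update_of_ne hxu] at hxc
      exact hc x h hxc hadj
  · rw [Function.update_self, Function.update_of_ne huv, Function.update_self]

lemma main_aux [Fintype V] {k : ℕ} (hreg : ∀ v : V, G.outDeg v = k ∧ G.inDeg v = k)
    (hc : G.Connected) (hchi : ¬ G.Dicolourable k) {u v : V} (huv : u ≠ v) {A B : Set V}
    (hs : G.Sep u v A B) : ¬ G.Adj u v := by
  classical
  intro harc
  have hkpos : 0 < k := by
    rw [← (hreg u).1]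
    haveI : Nonempty {w // G.Adj u w} := ⟨⟨v, harc⟩⟩
    exact Nat.card_pos
  obtain ⟨b, hb⟩ := hs.neB
  obtain ⟨a, ha⟩ := hs.neA
  obtain ⟨f, hf⟩ := G.proper_col hkpos hreg hc _ Bᶜ rfl ⟨b, fun h => h hb⟩
  obtain ⟨g, hg⟩ := G.proper_col hkpos hreg hc _ Aᶜ rfl ⟨a, fun h => h ha⟩
  by_cases h1 : ∀ f : V → Fin k, G.Col Bᶜ f → f u = f v
  · obtain ⟨g', hg', e⟩ := G.other_side hs huv harc hreg hf hg h1
    exact hchi (G.merge hs huv harc hf hg' (iff_of_true e (h1 f hf)))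
  by_cases h2 : ∀ g : V → Fin k, G.Col Aᶜ g → g u = g v
  · obtain ⟨f', hf', e⟩ := G.other_side (Sep.symm G hs) huv harc hreg hg hf h2
    exact hchi (G.merge hs huv harc hf' hg (iff_of_true (h2 g hg) e))
  push Not at h1 h2
  obtain ⟨f', hf', e⟩ := h1
  obtain ⟨g', hg', e'⟩ := h2
  exact hchi (G.merge hs huv harc hf' hg' (iff_of_false e' e))

end Helpers

end Digraph'

/-- In a connected `k`-regular counterexample-candidate (χ⃗ = k+1, not exceptional,
`k = Δ_max`), any 2-vertex cutset `{u, v}` of the underlying graph is a stable set: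
there is no arc between `u` and `v`. -/
theorem two_cutset_is_stable {V : Type} [Fintype V] (G : Digraph' V) (k : ℕ)
    (hreg : ∀ v : V, G.outDeg v = k ∧ G.inDeg v = k) (hk : G.DeltaMax = k)
    (hc : G.Connected) (hchi : G.dichromaticNumber = k + 1)
    (h1 : ¬ G.IsDirectedCycle) (h2 : ¬ G.IsSymmetricOddCycle)
    (h3 : ¬ G.IsSymmetricComplete)
    (u v : V) (huv : u ≠ v)
    (hcut : ¬ (G.induce {w : V | w ≠ u ∧ w ≠ v}).Connected) :
    ¬ G.Adj u v ∧ ¬ G.Adj v u := by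
  have hnot : ¬ G.Dicolourable k := by
    intro h
    have : G.dichromaticNumber ≤ k := Nat.sInf_le h
    omega
  by_cases hne : Nonempty {w : V | w ≠ u ∧ w ≠ v}
  · have hex : ∃ x y : {w : V | w ≠ u ∧ w ≠ v}, ¬ Relation.ReflTransGen
        (fun a b => (G.induce {w : V | w ≠ u ∧ w ≠ v}).Adj a b ∨
          (G.induce {w : V | w ≠ u ∧ w ≠ v}).Adj b a) x y := by
      by_contra hcon
      push Not at hcon
      exact hcut ⟨hne, hcon⟩
    obtain ⟨x, y, hxy⟩ := hex
    set R := (fun a b => (G.induce {w : V | w ≠ u ∧ w ≠ v}).Adj a b ∨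
          (G.induce {w : V | w ≠ u ∧ w ≠ v}).Adj b a) with hR
    let A : Set V := {w | ∃ h : w ≠ u ∧ w ≠ v, Relation.ReflTransGen R x ⟨w, h⟩}
    let B : Set V := {w | (w ≠ u ∧ w ≠ v) ∧ w ∉ A}
    have hAB : ∀ a ∈ A, ∀ b ∈ B, ¬ (G.Adj a b ∨ G.Adj b a) := by
      rintro a ⟨ha, hra⟩ b ⟨hb, hbA⟩ hadj
      exact hbA ⟨hb, hra.tail hadj⟩
    have hs : G.Sep u v A B :=
      { uA := fun h => h.1.1 rfl
        vA := fun h => h.1.2 rfl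
        uB := fun h => h.1.1 rfl
        vB := fun h => h.1.2 rfl
        disj := fun w hA hB => hB.2 hA
        cover := by
          intro w
          by_cases h1 : w = u
          · exact Or.inl h1
          by_cases h2 : w = v
          · exact Or.inr (Or.inl h2)
          by_cases h3 : w ∈ A
          · exact Or.inr (Or.inr (Or.inl h3))
          · exact Or.inr (Or.inr (Or.inr ⟨⟨h1, h2⟩, h3⟩))
        noAB := fun a ha b hb h => hAB a ha b hb (Or.inl h)
        noBA := fun a ha b hb h => hAB a ha b hb (Or.inr h)
        neA := ⟨x.1, x.2, .refl⟩
        neB := ⟨y.1, y.2, fun ⟨_, h⟩ => hxy h⟩ }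
    have hs' : G.Sep v u A B :=
      { uA := hs.vA
        vA := hs.uA
        uB := hs.vB
        vB := hs.uB
        disj := hs.disj
        cover := fun w => by have := hs.cover w; tauto
        noAB := hs.noAB
        noBA := hs.noBA
        neA := hs.neA
        neB := hs.neB }
    exact ⟨G.main_aux hreg hc hnot huv hs, G.main_aux hreg hc hnot huv.symm hs'⟩
  · have hall : ∀ w, w = u ∨ w = v := by
      intro w
      by_contra h
      push Not at h
      exact hne ⟨⟨w, h⟩⟩
    -- an arc into `q` forces an arc out of `q`, which can only go back
    have key : ∀ p q, (∀ w, w = p ∨ w = q) → G.Adj p q → G.Adj q p := by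
      intro p q hpq hadj
      haveI : Nonempty {w // G.Adj w q} := ⟨⟨p, hadj⟩⟩
      have h1 : 0 < G.inDeg q := Nat.card_pos
      rw [(hreg q).2, ← (hreg q).1] at h1
      obtain ⟨⟨w, hw⟩⟩ := (Nat.card_pos_iff.1 h1).1
      rcases hpq w with rfl | rfl
      · exact hw
      · exact absurd hw (G.irrefl _)
    have hall' : ∀ w, w = v ∨ w = u := fun w => (hall w).symm
    have hno : ¬ (G.Adj u v ∧ G.Adj v u) := by
      rintro ⟨ha, hb⟩
      apply h3
      intro a b
      constructor
      · rintro h rfl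
        exact G.irrefl _ h
      · intro h
        rcases hall a with rfl | rfl <;> rcases hall b with rfl | rfl
        · exact absurd rfl h
        · exact ha
        · exact hb
        · exact absurd rfl h
    exact ⟨fun h => hno ⟨h, key _ _ hall h⟩, fun h => hno ⟨key _ _ hall' h, h⟩⟩
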